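/- Let n, k, d be positive integers with d ≥ 2 and k ≤ n. If ∑_{j=0}^{d−2} C(n−1, j) < 2^{n−k}, then there exists a k-dimensional linear subspace C of F_2^n such that every nonzero codeword c ∈ C has Hamming weight at least d (Gilbert–Varshamov bound for binary linear codes). -/

import Mathlib

open Module Finset

/-- Greedy choice of the columns of a parity-check matrix: if the sums of at most `d - 2` of the
first `n - 1` columns cannot exhaust the group `V`, there are `n` elements of `V` such that no
nonempty family of fewer than `d` of them sums to zero. -/
lemma exists_forall_sum_ne_zero_of_sum_choose_lt_card {V : Type*} [AddCommGroup V] [Fintype V]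
    (n d : ℕ) (h : ∑ j ∈ range (d - 1), Nat.choose (n - 1) j < Fintype.card V) :
    ∃ f : ℕ → V, ∀ S ⊆ range n, S.Nonempty → S.card < d → ∑ i ∈ S, f i ≠ 0 := by
  classical
  suffices H : ∀ m ≤ n, ∃ f : ℕ → V, ∀ S ⊆ range m, S.Nonempty → S.card < d →
      ∑ i ∈ S, f i ≠ 0 from H n le_rfl
  intro m
  induction m with
  | zero =>
    intro _
    refine ⟨0, fun S hS hne => ?_⟩
    simp_all
  | succ m ih =>
    intro hm
    obtain ⟨f, hf⟩ := ih (by omega)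
    let B : Finset V := ((range (d - 1)).biUnion fun j => powersetCard j (range m)).image
      fun S => -∑ i ∈ S, f i
    have hB : B.card < Fintype.card V := by
      refine lt_of_le_of_lt (card_image_le.trans (card_biUnion_le.trans ?_)) h
      refine sum_le_sum fun j _ => ?_
      rw [card_powersetCard, card_range]
      exact Nat.choose_le_choose j (by omega)
    obtain ⟨v, hv⟩ : ∃ v, v ∉ B := by
      by_contra! hall
      exact hB.ne (by rw [eq_univ_of_forall hall, card_univ])
    have hupd : ∀ T : Finset ℕ, m ∉ T → ∑ i ∈ T, Function.update f m v i = ∑ i ∈ T, f i :=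
      fun T hT => sum_congr rfl fun i hi =>
        Function.update_of_ne (ne_of_mem_of_not_mem hi hT) _ _
    refine ⟨Function.update f m v, fun S hS hne hcard hsum => ?_⟩
    by_cases hmS : m ∈ S
    · rw [← add_sum_erase S _ hmS, hupd _ (notMem_erase m S), Function.update_self] at hsum
      refine hv (mem_image.2 ⟨S.erase m, ?_, (eq_neg_of_add_eq_zero_left hsum).symm⟩)
      have hpos := hne.card_pos
      refine mem_biUnion.2 ⟨(S.erase m).card, ?_, mem_powersetCard.2 ⟨?_, rfl⟩⟩
      · rw [mem_range, card_erase_of_mem hmS]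
        omega
      · rwa [← subset_insert_iff, ← range_add_one]
    · rw [hupd S hmS] at hsum
      refine hf S ?_ hne hcard hsum
      rwa [range_add_one, subset_insert_iff_of_notMem hmS] at hS

/-- A vector space contains a subspace of every dimension up to its own. -/
lemma Submodule.exists_le_finrank_eq_of_le {K M : Type*} [Field K] [AddCommGroup M] [Module K M]
    (W : Submodule K M) {k : ℕ} (hk : k ≤ finrank K W) : ∃ C ≤ W, finrank K C = k := by
  obtain ⟨b, hb⟩ := exists_linearIndependent_of_le_finrank hk
  refine ⟨(span K (Set.range b)).map W.subtype, W.map_subtype_le _, ?_⟩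
  rw [Submodule.finrank_map_subtype_eq, finrank_span_eq_card hb, Fintype.card_fin]

/-- Gilbert–Varshamov bound for binary linear codes: if
`∑_{j=0}^{d−2} C(n−1, j) < 2^{n−k}` with `d ≥ 2`, `0 < n`, `0 < k ≤ n`, then there exists
a `k`-dimensional subspace `C` of `F_2^n` all of whose nonzero codewords have Hamming
weight at least `d`. -/
theorem gilbert_varshamov_binary
    (n k d : ℕ) (hn : 0 < n) (hk : 0 < k) (hd : 2 ≤ d) (hkn : k ≤ n)
    (h : ∑ j ∈ range (d - 1), Nat.choose (n - 1) j < 2 ^ (n - k)) :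
    ∃ C : Submodule (ZMod 2) (Fin n → ZMod 2),
      finrank (ZMod 2) C = k ∧ ∀ c ∈ C, c ≠ 0 → d ≤ hammingNorm c := by
  obtain ⟨f, hf⟩ := exists_forall_sum_ne_zero_of_sum_choose_lt_card
    (V := Fin (n - k) → ZMod 2) n d (by simpa using h)
  let φ := Fintype.linearCombination (ZMod 2) fun i : Fin n => f i
  have hker : k ≤ finrank (ZMod 2) (LinearMap.ker φ) := by
    have hrn := φ.finrank_range_add_finrank_ker
    have hr := (LinearMap.range φ).finrank_le
    rw [finrank_fin_fun] at hrn hr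
    omega
  obtain ⟨C, hC, hCk⟩ := Submodule.exists_le_finrank_eq_of_le _ hker
  refine ⟨C, hCk, fun c hc hc0 => ?_⟩
  by_contra! hlt
  have hφ : ∑ i, c i • f i = 0 := hC hc
  let S : Finset (Fin n) := {i | c i ≠ 0}
  have hS : S.card = hammingNorm c := rfl
  refine hf (S.map Fin.valEmbedding) ?_ ?_ ?_ ?_
  · intro i hi
    obtain ⟨j, -, rfl⟩ := mem_map.1 hi
    exact mem_range.2 j.2
  · rw [map_nonempty, ← card_pos, hS]
    exact hammingNorm_pos_iff.2 hc0
  · rwa [card_map, hS]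
  · rw [sum_map, ← hφ, sum_filter]
    refine sum_congr rfl fun i _ => ?_
    split_ifs with hi
    · have hi1 : c i = 1 := Fin.eq_one_of_ne_zero _ hi
      rw [hi1, one_smul]
      rfl
    · rw [not_not.1 hi, zero_smul]
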